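/- arXiv:2305.17612 — 2 statements merged into one kernel-verified Lean document; each statement's English description precedes it below -/
import Mathlib

section
/- Let Ω₁ and Ω₂ be nonempty convex sets in ℝⁿ. Suppose one of the following holds: (a) ri Ω₁ ∩ ri Ω₂ ≠ ∅; (b) Ω₁ is a polyhedral convex set and Ω₁ ∩ ri Ω₂ ≠ ∅; (c) Ω₁ and Ω₂ are polyhedral convex sets and Ω₁ ∩ Ω₂ ≠ ∅. Then σ_{Ω₁∩Ω₂} = σ_{Ω₁} □ σ_{Ω₂}. Moreover, for every v with σ_{Ω₁∩Ω₂}(v) ∈ ℝ, there exist v₁, v₂ ∈ ℝⁿ with v = v₁ + v₂ and σ_{Ω₁∩Ω₂}(v) = σ_{Ω₁}(v₁) + σ_{Ω₂}(v₂). -/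
noncomputable section

/-- Euclidean pairing `⟨u, x⟩ = ∑ i, u i * x i` on `ℝⁿ`. -/
def sdot {n : ℕ} (u x : Fin n → ℝ) : ℝ := ∑ i, u i * x i

/-- Support function of `Ω ⊆ ℝⁿ`, with values in `ℝ ∪ {±∞}`. -/
def suppFn {n : ℕ} (Ω : Set (Fin n → ℝ)) (v : Fin n → ℝ) : EReal :=
  sSup ((fun x => ((sdot v x : ℝ) : EReal)) '' Ω)

/-- Infimal convolution `(g □ h)(v) = inf {g v₁ + h v₂ | v₁ + v₂ = v}`. -/
def infConv {n : ℕ} (g h : (Fin n → ℝ) → EReal) (v : Fin n → ℝ) : EReal :=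
  sInf {z : EReal | ∃ v1 v2, v1 + v2 = v ∧ z = g v1 + h v2}

/-- A polyhedral convex set is a finite intersection of half-spaces. -/
def IsPolyhedral {n : ℕ} (Ω : Set (Fin n → ℝ)) : Prop :=
  ∃ (m : ℕ) (a : Fin m → (Fin n → ℝ)) (b : Fin m → ℝ), Ω = {x | ∀ i, sdot (a i) x ≤ b i}

/-- **Farkas' lemma** over a finite index set: a linear functional that is nonpositive wherever
finitely many others are nonpositive is a nonnegative combination of them. -/
theorem exists_nonneg_sum_smul_eq {ι E : Type*} [AddCommGroup E] [Module ℝ E] (s : Finset ι)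
    (c : ι → E →ₗ[ℝ] ℝ) (d : E →ₗ[ℝ] ℝ)
    (h : ∀ z, (∀ i ∈ s, c i z ≤ 0) → d z ≤ 0) :
    ∃ w : ι → ℝ, (∀ i ∈ s, 0 ≤ w i) ∧ d = ∑ i ∈ s, w i • c i := by
  classical
  induction s using Finset.induction_on generalizing c d with
  | empty =>
    refine ⟨0, by simp, LinearMap.ext fun z => ?_⟩
    have h₁ := h z (by simp)
    have h₂ := h (-z) (by simp)
    simp only [map_neg] at h₂
    simp only [Finset.sum_empty, LinearMap.zero_apply]
    linarith
  | insert j s hj ih =>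
    by_cases hs : ∀ z, (∀ i ∈ s, c i z ≤ 0) → d z ≤ 0
    · obtain ⟨w, hw, hd⟩ := ih c d hs
      refine ⟨Function.update w j 0, fun i hi => ?_, ?_⟩
      · by_cases hij : i = j
        · simp [hij]
        · simpa [hij] using hw i (Finset.mem_of_mem_insert_of_ne hi hij)
      · rw [Finset.sum_insert hj, hd, Function.update_self, zero_smul, zero_add]
        exact Finset.sum_congr rfl fun i hi => by
          rw [Function.update_of_ne (ne_of_mem_of_not_mem hi hj)]
    · push Not at hs
      obtain ⟨y, hy, hdy⟩ := hs
      have hcy : 0 < c j y := by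
        by_contra! hle
        refine hdy.not_ge (h y fun i hi => ?_)
        rcases Finset.mem_insert.1 hi with rfl | hi
        exacts [hle, hy i hi]
      obtain ⟨w, hw, hd⟩ := ih (fun i => c i - (c i y / c j y) • c j)
        (d - (d y / c j y) • c j) fun z hz => by
          have key := h (z - (c j z / c j y) • y) fun i hi => by
            rcases Finset.mem_insert.1 hi with rfl | hi
            · simp [hcy.ne']
            · have := hz i hi
              simp only [LinearMap.sub_apply, LinearMap.smul_apply, smul_eq_mul, map_sub,
                map_smul] at this ⊢
              convert this using 2
              ring
          simp only [LinearMap.sub_apply, LinearMap.smul_apply, smul_eq_mul, map_sub,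
            map_smul] at key ⊢
          convert key using 2
          ring
      have hpos : 0 ≤ d y / c j y - ∑ i ∈ s, w i * (c i y / c j y) := by
        have : ∑ i ∈ s, w i * (c i y / c j y) ≤ 0 := Finset.sum_nonpos fun i hi =>
          mul_nonpos_of_nonneg_of_nonpos (hw i hi) (div_nonpos_of_nonpos_of_nonneg (hy i hi) hcy.le)
        have := div_pos hdy hcy
        linarith
      refine ⟨Function.update w j (d y / c j y - ∑ i ∈ s, w i * (c i y / c j y)), fun i hi => ?_, ?_⟩
      · by_cases hij : i = j
        · simpa [hij] using hpos
        · simpa [hij] using hw i (Finset.mem_of_mem_insert_of_ne hi hij)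
      · have hsum : ∑ i ∈ s, Function.update w j (d y / c j y - ∑ i ∈ s, w i * (c i y / c j y)) i • c i
            = ∑ i ∈ s, w i • c i := Finset.sum_congr rfl fun i hi => by
          rw [Function.update_of_ne (ne_of_mem_of_not_mem hi hj)]
        rw [Finset.sum_insert hj, Function.update_self, hsum]
        rw [sub_eq_iff_eq_add] at hd
        refine hd.trans ?_
        ext x
        simp only [LinearMap.add_apply, LinearMap.sum_apply, LinearMap.smul_apply,
          LinearMap.sub_apply, smul_eq_mul, mul_sub, sub_mul, Finset.sum_sub_distrib,
          Finset.sum_mul, mul_assoc]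
        ring

/-- Affine version of **Farkas' lemma**: a bound for a linear functional over a nonempty polyhedron
is a nonnegative combination of the constraints. -/
theorem exists_nonneg_sum_smul_eq_of_le {ι E : Type*} [Fintype ι] [AddCommGroup E] [Module ℝ E]
    (a : ι → E →ₗ[ℝ] ℝ) (b : ι → ℝ) (v : E →ₗ[ℝ] ℝ) (r : ℝ) {x₀ : E} (hx₀ : ∀ i, a i x₀ ≤ b i)
    (h : ∀ x, (∀ i, a i x ≤ b i) → v x ≤ r) :
    ∃ w : ι → ℝ, (∀ i, 0 ≤ w i) ∧ v = ∑ i, w i • a i ∧ ∑ i, w i * b i ≤ r := by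
  obtain ⟨w, hw, hv⟩ := exists_nonneg_sum_smul_eq (Finset.univ : Finset (Option ι))
    (fun o => o.elim (-LinearMap.snd ℝ E ℝ)
      fun i => a i ∘ₗ LinearMap.fst ℝ E ℝ - b i • LinearMap.snd ℝ E ℝ)
    (v ∘ₗ LinearMap.fst ℝ E ℝ - r • LinearMap.snd ℝ E ℝ) (by
      rintro ⟨x, t⟩ hz
      have ht : 0 ≤ t := by simpa using hz none (Finset.mem_univ _)
      have hx : ∀ i, a i x ≤ b i * t := fun i => by
        simpa using hz (some i) (Finset.mem_univ _)
      simp only [LinearMap.sub_apply, LinearMap.comp_apply, LinearMap.fst_apply,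
        LinearMap.smul_apply, LinearMap.snd_apply, smul_eq_mul, sub_nonpos]
      rcases ht.eq_or_lt with rfl | ht
      · by_contra! hlt
        rw [mul_zero] at hlt
        have hk : ∀ k : ℝ, 0 ≤ k → v x₀ + k * v x ≤ r := fun k hk => by
          simpa using h (x₀ + k • x) fun i => by
            have := mul_nonpos_of_nonneg_of_nonpos hk ((hx i).trans_eq (mul_zero _))
            simpa using add_le_add (hx₀ i) this
        have h₀ : v x₀ ≤ r := h x₀ hx₀
        have h₁ := hk ((r - v x₀ + 1) / v x) (div_nonneg (by linarith) hlt.le)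
        rw [div_mul_cancel₀ _ hlt.ne'] at h₁
        linarith
      · have := h (t⁻¹ • x) fun i => by
          rw [map_smul, smul_eq_mul, inv_mul_le_iff₀ ht, mul_comm]
          exact hx i
        rw [map_smul, smul_eq_mul, inv_mul_le_iff₀ ht, mul_comm] at this
        exact this)
  refine ⟨fun i => w (some i), fun i => hw _ (Finset.mem_univ _), LinearMap.ext fun x => ?_, ?_⟩
  · simpa [Fintype.sum_option] using LinearMap.congr_fun hv (x, 0)
  · have h₁ := LinearMap.congr_fun hv (0, 1)
    have h₀ := hw none (Finset.mem_univ _)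
    simp only [Fintype.sum_option, Option.elim, LinearMap.add_apply, LinearMap.sum_apply,
      LinearMap.sub_apply, LinearMap.comp_apply, LinearMap.smul_apply, LinearMap.neg_apply,
      LinearMap.fst_apply, LinearMap.snd_apply, map_zero, smul_eq_mul, mul_one, zero_sub,
      mul_neg, Finset.sum_neg_distrib] at h₁
    linarith

theorem sdot_add_left {n : ℕ} (u v x : Fin n → ℝ) : sdot (u + v) x = sdot u x + sdot v x :=
  add_dotProduct u v x

/-- A set cut out by finitely many inequalities between linear functionals and constants is
polyhedral. -/
theorem isPolyhedral_setOf_forall_le {n : ℕ} {ι : Type*} [Fintype ι]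
    (f : ι → (Fin n → ℝ) →ₗ[ℝ] ℝ) (b : ι → ℝ) : IsPolyhedral {x | ∀ i, f i x ≤ b i} := by
  let e := (Fintype.equivFin ι).symm
  refine ⟨Fintype.card ι, fun i => (dotProductEquiv ℝ (Fin n)).symm (f (e i)), fun i => b (e i), ?_⟩
  have hf : ∀ i x, sdot ((dotProductEquiv ℝ (Fin n)).symm (f i)) x = f i x := fun i x =>
    LinearMap.congr_fun ((dotProductEquiv ℝ (Fin n)).apply_symm_apply (f i)) x
  ext x
  simp only [hf, Set.mem_ofPred_eq]
  exact (e.forall_congr_right (q := fun i => f i x ≤ b i)).symm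

theorem IsPolyhedral.inter {n : ℕ} {P Q : Set (Fin n → ℝ)} (hP : IsPolyhedral P)
    (hQ : IsPolyhedral Q) : IsPolyhedral (P ∩ Q) := by
  obtain ⟨m, a, b, rfl⟩ := hP
  obtain ⟨k, a', b', rfl⟩ := hQ
  convert isPolyhedral_setOf_forall_le
    (Sum.elim (fun i => dotProductEquiv ℝ (Fin n) (a i)) fun i => dotProductEquiv ℝ (Fin n) (a' i))
    (Sum.elim b b') using 1
  ext x
  simp only [Set.mem_inter_iff, Set.mem_ofPred_eq, Sum.forall, Sum.elim_inl, Sum.elim_inr]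
  rfl

theorem IsPolyhedral.convex {n : ℕ} {P : Set (Fin n → ℝ)} (hP : IsPolyhedral P) : Convex ℝ P := by
  obtain ⟨m, a, b, rfl⟩ := hP
  rw [Set.ofPred_forall]
  exact convex_iInter fun i => convex_halfSpace_le (dotProductEquiv ℝ (Fin n) (a i)).isLinear _

theorem isPolyhedral_setOf_sub_mem {n : ℕ} (W : Submodule ℝ (Fin n → ℝ)) (x₀ : Fin n → ℝ) :
    IsPolyhedral {x | x - x₀ ∈ W} := by
  obtain ⟨U, hU⟩ := W.exists_isCompl
  let L : (Fin n → ℝ) →ₗ[ℝ] (Fin n → ℝ) := U.subtype ∘ₗ U.projectionOnto W hU.symm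
  have hL : ∀ y, y ∈ W ↔ L y = 0 := fun y => by
    simp [L]
  let p : Fin n → (Fin n → ℝ) →ₗ[ℝ] ℝ := fun i => LinearMap.proj i ∘ₗ L
  convert isPolyhedral_setOf_forall_le (Sum.elim p (-p))
    (Sum.elim (fun i => p i x₀) fun i => -p i x₀) using 1
  ext x
  simp only [Set.mem_ofPred_eq, hL, map_sub, sub_eq_zero, Sum.forall, Sum.elim_inl, Sum.elim_inr,
    Pi.neg_apply, LinearMap.neg_apply, neg_le_neg_iff, ← forall_and, ← le_antisymm_iff]
  exact funext_iff

/-- If a linear functional is bounded by `r` on `C ∩ D` and some point of `D` lies in the relative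
interior of `C`, then `C` can be enlarged to a polyhedral set without affecting the bound. -/
theorem exists_isPolyhedral_superset_of_le {n : ℕ} {C D : Set (Fin n → ℝ)} (hC : Convex ℝ C)
    (hD : Convex ℝ D) {x₀ : Fin n → ℝ} (hx₀C : x₀ ∈ intrinsicInterior ℝ C) (hx₀D : x₀ ∈ D)
    (v : (Fin n → ℝ) →ₗ[ℝ] ℝ) {r : ℝ} (h : ∀ x ∈ C ∩ D, v x ≤ r) :
    ∃ Q, IsPolyhedral Q ∧ C ⊆ Q ∧ ∀ x ∈ Q ∩ D, v x ≤ r := by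
  have hx₀ : x₀ ∈ C := intrinsicInterior_subset hx₀C
  have hx₀A : x₀ ∈ affineSpan ℝ C := subset_affineSpan ℝ C hx₀
  let W := (affineSpan ℝ C).direction
  let s : Set W := {w | (w : Fin n → ℝ) + x₀ ∈ C}
  let t : Set W := {w | (w : Fin n → ℝ) + x₀ ∈ D ∧ r < v ((w : Fin n → ℝ) + x₀)}
  have hconv : ∀ K : Set (Fin n → ℝ), Convex ℝ K →
      Convex ℝ {w : W | (w : Fin n → ℝ) + x₀ ∈ K} := fun K hK =>
    (hK.translate_preimage_left x₀).linear_preimage W.subtype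
  have hs : Convex ℝ s := hconv C hC
  have ht : Convex ℝ t := (hconv D hD).inter (hconv _ (convex_halfSpace_gt v.isLinear r))
  have hs₀ : (0 : W) ∈ interior s := by
    obtain ⟨y, hy, hyx⟩ := mem_intrinsicInterior.1 hx₀C
    let φ : W → affineSpan ℝ C := fun w =>
      ⟨(w : Fin n → ℝ) + x₀, AffineSubspace.vadd_mem_of_mem_direction w.2 hx₀A⟩
    have hφ : Continuous φ := by fun_prop
    have hφ₀ : φ 0 = y := Subtype.ext (by simp [φ, hyx])
    exact preimage_interior_subset_interior_preimage hφ (hφ₀ ▸ hy : φ 0 ∈ _)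
  obtain ⟨f, u, hfs, hft⟩ := geometric_hahn_banach_open hs.interior isOpen_interior ht
    (Set.disjoint_left.2 fun w hw hwt =>
      hwt.2.not_ge (h _ ⟨(interior_subset hw : w ∈ s), hwt.1⟩))
  have hu : 0 < u := by simpa using hfs 0 hs₀
  have hfs' : ∀ w ∈ s, f w ≤ u := fun w hw => by
    have hcl : closure (interior s) ⊆ {w | f w ≤ u} :=
      closure_minimal (fun w hw => (hfs w hw).le) (isClosed_le f.continuous continuous_const)
    rw [hs.closure_interior_eq_closure_of_nonempty_interior ⟨0, hs₀⟩] at hcl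
    exact hcl (subset_closure hw)
  obtain ⟨g, hg⟩ := LinearMap.exists_extend (f : W →ₗ[ℝ] ℝ)
  have hgf : ∀ w : W, g w = f w := fun w => LinearMap.congr_fun hg w
  refine ⟨{x | x - x₀ ∈ W} ∩ {x | ∀ _ : Unit, g x ≤ u + g x₀},
    (isPolyhedral_setOf_sub_mem W x₀).inter (isPolyhedral_setOf_forall_le _ _),
    fun x hx => ?_, ?_⟩
  · have hxW : x - x₀ ∈ W := AffineSubspace.vsub_mem_direction (subset_affineSpan ℝ C hx) hx₀A
    refine ⟨hxW, fun _ => ?_⟩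
    have := hfs' ⟨x - x₀, hxW⟩ (by simpa [s] using hx)
    rw [← hgf, map_sub] at this
    linarith
  · rintro x ⟨⟨hxW, hxu⟩, hxD⟩
    have hxu' : f ⟨x - x₀, hxW⟩ ≤ u := by
      rw [← hgf, map_sub]
      linarith [hxu ()]
    have hv₀ : v x₀ ≤ r := h x₀ ⟨hx₀, hx₀D⟩
    have hseg : ∀ k : ℝ, 0 ≤ k → k < 1 → k * (v x - v x₀) + v x₀ ≤ r := fun k hk₀ hk₁ => by
      by_contra! hlt
      have := hft (k • ⟨x - x₀, hxW⟩) ⟨by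
        simpa [add_comm] using hD.add_smul_sub_mem hx₀D hxD ⟨hk₀, hk₁.le⟩, by simpa using hlt⟩
      rw [map_smul, smul_eq_mul] at this
      nlinarith
    by_contra! hlt
    have hpos : 0 < v x - v x₀ := by linarith
    have := hseg ((v x + r - 2 * v x₀) / (2 * (v x - v x₀)))
      (div_nonneg (by linarith) (by linarith)) ((div_lt_one (by linarith)).2 (by linarith))
    have heq : (v x + r - 2 * v x₀) / (2 * (v x - v x₀)) * (v x - v x₀)
        = (v x + r - 2 * v x₀) / 2 := by
      field_simp
    linarith

theorem suppFn_le_coe_iff {n : ℕ} {Ω : Set (Fin n → ℝ)} {v : Fin n → ℝ} {r : ℝ} :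
    suppFn Ω v ≤ r ↔ ∀ x ∈ Ω, sdot v x ≤ r := by
  simp [suppFn, sSup_le_iff]

theorem sdot_le_suppFn {n : ℕ} {Ω : Set (Fin n → ℝ)} (v : Fin n → ℝ) {x : Fin n → ℝ} (hx : x ∈ Ω) :
    (sdot v x : EReal) ≤ suppFn Ω v :=
  le_sSup ⟨x, hx, rfl⟩

theorem suppFn_mono {n : ℕ} {Ω Ω' : Set (Fin n → ℝ)} (h : Ω ⊆ Ω') (v : Fin n → ℝ) :
    suppFn Ω v ≤ suppFn Ω' v :=
  sSup_le_sSup (Set.image_mono h)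

theorem suppFn_inter_add_le {n : ℕ} (Ω1 Ω2 : Set (Fin n → ℝ)) (v1 v2 : Fin n → ℝ) :
    suppFn (Ω1 ∩ Ω2) (v1 + v2) ≤ suppFn Ω1 v1 + suppFn Ω2 v2 := by
  refine sSup_le ?_
  rintro _ ⟨x, ⟨hx1, hx2⟩, rfl⟩
  simp only [sdot_add_left, EReal.coe_add]
  exact add_le_add (sdot_le_suppFn v1 hx1) (sdot_le_suppFn v2 hx2)

/-- The support function of an intersection of two polyhedral sets splits. -/
theorem IsPolyhedral.exists_suppFn_add_le {n : ℕ} {P Q : Set (Fin n → ℝ)} (hP : IsPolyhedral P)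
    (hQ : IsPolyhedral Q) (hPQ : (P ∩ Q).Nonempty) {v : Fin n → ℝ} {r : ℝ}
    (h : ∀ x ∈ P ∩ Q, sdot v x ≤ r) :
    ∃ v1 v2, v1 + v2 = v ∧ suppFn P v1 + suppFn Q v2 ≤ r := by
  obtain ⟨m, a, b, rfl⟩ := hP
  obtain ⟨k, a', b', rfl⟩ := hQ
  obtain ⟨x₀, hx₀, hx₀'⟩ := hPQ
  let e := dotProductEquiv ℝ (Fin n)
  obtain ⟨w, hw, hv, hr⟩ := exists_nonneg_sum_smul_eq_of_le
    (Sum.elim (fun i => e (a i)) fun i => e (a' i)) (Sum.elim b b') (e v) r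
    (x₀ := x₀) (Sum.forall.2 ⟨hx₀, hx₀'⟩)
    fun x hx => h x ⟨fun i => hx (.inl i), fun i => hx (.inr i)⟩
  simp only [Fintype.sum_sum_type, Sum.elim_inl, Sum.elim_inr] at hv hr
  have bound : ∀ (l : ℕ) (c : Fin l → Fin n → ℝ) (d w' : Fin l → ℝ), (∀ i, 0 ≤ w' i) →
      suppFn {x | ∀ i, sdot (c i) x ≤ d i} (∑ i, w' i • c i) ≤ (∑ i, w' i * d i : ℝ) :=
    fun l c d w' hw' => suppFn_le_coe_iff.2 fun x hx => by
      have : sdot (∑ i, w' i • c i) x = ∑ i, w' i * sdot (c i) x := by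
        change (∑ i, w' i • c i) ⬝ᵥ x = ∑ i, w' i * (c i ⬝ᵥ x)
        simp [sum_dotProduct]
      rw [this]
      exact Finset.sum_le_sum fun i _ => mul_le_mul_of_nonneg_left (hx i) (hw' i)
  refine ⟨∑ i, w (.inl i) • a i, ∑ i, w (.inr i) • a' i, e.injective ?_, ?_⟩
  · simp [hv]
  · refine (add_le_add (bound m a b _ fun i => hw _) (bound k a' b' _ fun i => hw _)).trans ?_
    exact_mod_cast hr

/-- Support function intersection rule in `ℝⁿ` under (a) relative interior,
(b) polyhedral/relative interior, or (c) polyhedral qualification conditions;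
the infimal convolution is exact at every point where `σ_{Ω₁∩Ω₂}` is finite. -/
theorem support_intersection_rule {n : ℕ} (Ω1 Ω2 : Set (Fin n → ℝ))
    (h1 : Ω1.Nonempty) (h2 : Ω2.Nonempty) (hc1 : Convex ℝ Ω1) (hc2 : Convex ℝ Ω2)
    (hqc : (intrinsicInterior ℝ Ω1 ∩ intrinsicInterior ℝ Ω2).Nonempty ∨
      (IsPolyhedral Ω1 ∧ (Ω1 ∩ intrinsicInterior ℝ Ω2).Nonempty) ∨
      (IsPolyhedral Ω1 ∧ IsPolyhedral Ω2 ∧ (Ω1 ∩ Ω2).Nonempty)) :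
    (∀ v, suppFn (Ω1 ∩ Ω2) v = infConv (suppFn Ω1) (suppFn Ω2) v) ∧
    (∀ v (r : ℝ), suppFn (Ω1 ∩ Ω2) v = (r : EReal) →
      ∃ v1 v2, v1 + v2 = v ∧ suppFn (Ω1 ∩ Ω2) v = suppFn Ω1 v1 + suppFn Ω2 v2) := by
  have hne : (Ω1 ∩ Ω2).Nonempty := by
    rcases hqc with ⟨x, hx1, hx2⟩ | ⟨-, x, hx1, hx2⟩ | ⟨-, -, h⟩
    · exact ⟨x, intrinsicInterior_subset hx1, intrinsicInterior_subset hx2⟩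
    · exact ⟨x, hx1, intrinsicInterior_subset hx2⟩
    · exact h
  have hpoly : ∀ v (r : ℝ), (∀ x ∈ Ω1 ∩ Ω2, sdot v x ≤ r) →
      ∃ P Q, IsPolyhedral P ∧ IsPolyhedral Q ∧ Ω1 ⊆ P ∧ Ω2 ⊆ Q ∧ ∀ x ∈ P ∩ Q, sdot v x ≤ r := by
    have hright : ∀ v (r : ℝ) P, IsPolyhedral P → (P ∩ intrinsicInterior ℝ Ω2).Nonempty →
        (∀ x ∈ P ∩ Ω2, sdot v x ≤ r) →
        ∃ Q, IsPolyhedral Q ∧ Ω2 ⊆ Q ∧ ∀ x ∈ P ∩ Q, sdot v x ≤ r := by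
      rintro v r P hP ⟨x, hxP, hx2⟩ h
      obtain ⟨Q, hQ, hsub, hQv⟩ := exists_isPolyhedral_superset_of_le hc2 hP.convex hx2 hxP
        (dotProductEquiv ℝ (Fin n) v) fun x hx => h x hx.symm
      exact ⟨Q, hQ, hsub, fun x hx => hQv x hx.symm⟩
    intro v r h
    rcases hqc with ⟨x, hx1, hx2⟩ | ⟨hP, hx⟩ | ⟨hP, hQ, -⟩
    · obtain ⟨P, hP, hsub, hPv⟩ := exists_isPolyhedral_superset_of_le hc1 hc2 hx1
        (intrinsicInterior_subset hx2) (dotProductEquiv ℝ (Fin n) v) h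
      obtain ⟨Q, hQ, hsub', hQv⟩ :=
        hright v r P hP ⟨x, hsub (intrinsicInterior_subset hx1), hx2⟩ hPv
      exact ⟨P, Q, hP, hQ, hsub, hsub', hQv⟩
    · obtain ⟨Q, hQ, hsub, hQv⟩ := hright v r Ω1 hP hx h
      exact ⟨Ω1, Q, hP, hQ, subset_rfl, hsub, hQv⟩
    · exact ⟨Ω1, Ω2, hP, hQ, subset_rfl, subset_rfl, h⟩
  have hsplit : ∀ v (r : ℝ), suppFn (Ω1 ∩ Ω2) v = r →
      ∃ v1 v2, v1 + v2 = v ∧ suppFn (Ω1 ∩ Ω2) v = suppFn Ω1 v1 + suppFn Ω2 v2 := by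
    intro v r hr
    obtain ⟨P, Q, hP, hQ, h1P, h2Q, h⟩ := hpoly v r (suppFn_le_coe_iff.1 hr.le)
    obtain ⟨v1, v2, rfl, hle⟩ :=
      hP.exists_suppFn_add_le hQ (hne.mono (Set.inter_subset_inter h1P h2Q)) h
    refine ⟨v1, v2, rfl, (suppFn_inter_add_le Ω1 Ω2 v1 v2).antisymm ?_⟩
    exact ((add_le_add (suppFn_mono h1P v1) (suppFn_mono h2Q v2)).trans hle).trans hr.ge
  refine ⟨fun v => le_antisymm (le_sInf ?_) ?_, hsplit⟩
  · rintro _ ⟨v1, v2, rfl, rfl⟩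
    exact suppFn_inter_add_le Ω1 Ω2 v1 v2
  · obtain ⟨x, hx⟩ := hne
    have hbot := sdot_le_suppFn v hx
    generalize hσ : suppFn (Ω1 ∩ Ω2) v = σ at hbot ⊢
    induction σ with
    | bot => simp at hbot
    | top => exact le_top
    | coe r =>
      obtain ⟨v1, v2, hv, heq⟩ := hsplit v r hσ
      exact sInf_le ⟨v1, v2, hv, hσ ▸ heq⟩

end
end

section
/- Let F: ℝⁿ ⇉ ℝᵖ and G: ℝᵖ ⇉ ℝ^q be set-valued mappings. Then for every (u, w) ∈ ℝⁿ × ℝ^q, (G∘F)*(u, w) ≤ inf{F*(u, v) + G*(−v, w) | v ∈ ℝᵖ}. If moreover one of the following holds: (a) F and G are convex and ri(rge F) ∩ ri(dom G) ≠ ∅; (b) F is polyhedral convex, G is convex, and rge F ∩ ri(dom G) ≠ ∅ (or F is convex, G is polyhedral convex, and ri(rge F) ∩ dom G ≠ ∅); (c) F and G are polyhedral convex and rge F ∩ dom G ≠ ∅; then (G∘F)*(u, w) = inf{F*(u, v) + G*(−v, w) | v ∈ ℝᵖ}, and the infimum is attained whenever (G∘F)*(u, w) ∈ ℝ. -/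
noncomputable section

/-- Fenchel conjugate of a set-valued mapping `F : ℝⁿ ⇉ ℝᵖ`. -/
def svConj {n p : ℕ} (F : (Fin n → ℝ) → Set (Fin p → ℝ))
    (u : Fin n → ℝ) (v : Fin p → ℝ) : EReal :=
  sSup ((fun q : (Fin n → ℝ) × (Fin p → ℝ) => ((sdot u q.1 + sdot v q.2 : ℝ) : EReal)) ''
    {q : (Fin n → ℝ) × (Fin p → ℝ) | q.2 ∈ F q.1})

/-- Effective domain of a set-valued mapping. -/
def sdom {n p : ℕ} (F : (Fin n → ℝ) → Set (Fin p → ℝ)) : Set (Fin n → ℝ) :=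
  {x | (F x).Nonempty}

/-- Range of a set-valued mapping. -/
def srge {n p : ℕ} (F : (Fin n → ℝ) → Set (Fin p → ℝ)) : Set (Fin p → ℝ) :=
  {y | ∃ x, y ∈ F x}

/-- A polyhedral convex set-valued mapping: the graph is a finite intersection of
half-spaces in `ℝⁿ × ℝᵖ`. -/
def IsPolyMap {n p : ℕ} (F : (Fin n → ℝ) → Set (Fin p → ℝ)) : Prop :=
  ∃ (m : ℕ) (a : Fin m → (Fin n → ℝ)) (c : Fin m → (Fin p → ℝ)) (b : Fin m → ℝ),
    {q : (Fin n → ℝ) × (Fin p → ℝ) | q.2 ∈ F q.1} =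
      {q | ∀ i, sdot (a i) q.1 + sdot (c i) q.2 ≤ b i}

open Filter Topology

section Multipliers

variable {W ι : Type*} [AddCommGroup W] [Module ℝ W]

/-- On a convex cone where `ℓ` takes both signs or vanishes, nonpositivity of `ψ` on the kernel
of `ℓ` yields a Lagrange multiplier. -/
lemma ConvexCone.exists_multiplier_of_eq_zero (Γ : ConvexCone ℝ W) (ℓ ψ : W →ₗ[ℝ] ℝ)
    (hsign : (∃ g ∈ Γ, 0 < ℓ g) ↔ ∃ g ∈ Γ, ℓ g < 0)
    (hψ : ∀ g ∈ Γ, ℓ g = 0 → ψ g ≤ 0) : ∃ ν : ℝ, ∀ g ∈ Γ, ψ g ≤ ν * ℓ g := by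
  by_cases hpos : ∃ g ∈ Γ, 0 < ℓ g
  · have hneg := hsign.1 hpos
    obtain ⟨ν, hν₁, hν₂⟩ := exists_between_of_forall_le
      (s := (fun g => ψ g / ℓ g) '' {g | g ∈ Γ ∧ 0 < ℓ g})
      (t := (fun g => ψ g / ℓ g) '' {g | g ∈ Γ ∧ ℓ g < 0})
      (by obtain ⟨g, hg⟩ := hpos; exact ⟨_, g, hg, rfl⟩)
      (by obtain ⟨g, hg⟩ := hneg; exact ⟨_, g, hg, rfl⟩)
      (by
        rintro _ ⟨g, ⟨hg, hg0⟩, rfl⟩ _ ⟨k, ⟨hk, hk0⟩, rfl⟩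
        have h := hψ ((-ℓ k) • g + ℓ g • k)
          (Γ.add_mem (Γ.smul_mem (neg_pos.2 hk0) hg) (Γ.smul_mem hg0 hk))
          (by simp only [map_add, map_smul, smul_eq_mul]; ring)
        simp only [map_add, map_smul, smul_eq_mul] at h
        change ψ g / ℓ g ≤ ψ k / ℓ k
        rw [div_le_iff₀ hg0, div_mul_eq_mul_div, le_div_iff_of_neg hk0]
        linarith)
    refine ⟨ν, fun g hg => ?_⟩
    rcases lt_trichotomy (ℓ g) 0 with h | h | h
    · exact (le_div_iff_of_neg h).1 (hν₂ ⟨g, ⟨hg, h⟩, rfl⟩)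
    · simpa [h] using hψ g hg h
    · exact (div_le_iff₀ h).1 (hν₁ ⟨g, ⟨hg, h⟩, rfl⟩)
  · have hneg : ¬ ∃ g ∈ Γ, ℓ g < 0 := fun h => hpos (hsign.2 h)
    push Not at hpos hneg
    exact ⟨0, fun g hg => by simpa using hψ g hg (le_antisymm (hpos g hg) (hneg g hg))⟩

/-- Lagrange multiplier for one linear constraint satisfied strictly at some point of the cone. -/
lemma ConvexCone.exists_nonneg_multiplier_of_neg (Γ : ConvexCone ℝ W) (ℓ ψ : W →ₗ[ℝ] ℝ)
    {g₀ : W} (hg₀ : g₀ ∈ Γ) (hneg : ℓ g₀ < 0) (hψ : ∀ g ∈ Γ, ℓ g ≤ 0 → ψ g ≤ 0) :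
    ∃ ν : ℝ, 0 ≤ ν ∧ ∀ g ∈ Γ, ψ g ≤ ν * ℓ g := by
  by_cases hpos : ∃ g ∈ Γ, 0 < ℓ g
  · obtain ⟨ν, hν⟩ := Γ.exists_multiplier_of_eq_zero ℓ ψ
      (iff_of_true hpos ⟨g₀, hg₀, hneg⟩) (fun g hg h => hψ g hg h.le)
    refine ⟨max ν 0, le_max_right _ _, fun g hg => ?_⟩
    rcases le_total ν 0 with h | h
    · rw [max_eq_right h, zero_mul]
      rcases le_total (ℓ g) 0 with h' | h'
      · exact hψ g hg h'
      · exact (hν g hg).trans (mul_nonpos_of_nonpos_of_nonneg h h')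
    · rw [max_eq_left h]
      exact hν g hg
  · push Not at hpos
    exact ⟨0, le_rfl, fun g hg => by simpa using hψ g hg (hpos g hg)⟩

/-- Farkas' lemma relative to a convex cone: the inequality `ψ ≤ 0` on the part of the cone cut
out by the constraints `ℓ i ≤ 0` has multipliers as soon as the constraints hold at a point that
is relatively interior as far as the values of the `ℓ i` are concerned. -/
theorem ConvexCone.exists_nonneg_multipliers (s : Finset ι) (Γ : ConvexCone ℝ W)
    (ℓ : ι → W →ₗ[ℝ] ℝ) (ψ : W →ₗ[ℝ] ℝ) {g₀ : W} (hg₀ : g₀ ∈ Γ) (hfeas : ∀ i ∈ s, ℓ i g₀ ≤ 0)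
    (hri : ∀ g ∈ Γ, ∃ N : ℝ, 0 < N ∧ ∃ g' ∈ Γ, ∀ i ∈ s, ℓ i g' = N * ℓ i g₀ - ℓ i g)
    (hψ : ∀ g ∈ Γ, (∀ i ∈ s, ℓ i g ≤ 0) → ψ g ≤ 0) :
    ∃ c : ι → ℝ, (∀ i, 0 ≤ c i) ∧ ∀ g ∈ Γ, ψ g ≤ ∑ i ∈ s, c i * ℓ i g := by
  classical
  induction s using Finset.induction_on generalizing Γ ψ g₀ with
  | empty => exact ⟨0, fun _ => le_rfl, fun g hg => by simpa using hψ g hg (by simp)⟩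
  | insert a s ha ih =>
    simp only [Finset.forall_mem_insert] at hfeas hri hψ
    have hsum : ∀ (c : ι → ℝ) (ν : ℝ) (g : W),
        ∑ i ∈ insert a s, Function.update c a ν i * ℓ i g
          = ν * ℓ a g + ∑ i ∈ s, c i * ℓ i g := by
      intro c ν g
      rw [Finset.sum_insert ha, Function.update_self]
      congr 1
      refine Finset.sum_congr rfl fun i hi => ?_
      rw [Function.update_of_ne (ne_of_mem_of_not_mem hi ha)]
    have hupd : ∀ (c : ι → ℝ) (ν : ℝ), (∀ i, 0 ≤ c i) → 0 ≤ ν →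
        ∀ i, 0 ≤ Function.update c a ν i := by
      intro c ν hc hν i
      rcases eq_or_ne i a with rfl | h
      · simpa using hν
      · simpa [h] using hc i
    have hle : ∀ g, g ∈ Γ ⊓ (ConvexCone.positive ℝ ℝ).comap (-ℓ a) ↔ g ∈ Γ ∧ ℓ a g ≤ 0 := by
      intro g
      simp [ConvexCone.mem_inf]
    by_cases hstrict : ∃ g ∈ Γ, (∀ i ∈ s, ℓ i g ≤ 0) ∧ ℓ a g < 0
    · obtain ⟨g₁, hg₁, hg₁s, hg₁a⟩ := hstrict
      have hneg : ℓ a (g₀ + g₁) < 0 := by rw [map_add]; linarith [hfeas.1]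
      have hmem := Γ.add_mem hg₀ hg₁
      obtain ⟨c, hc, hcψ⟩ := ih (Γ ⊓ (ConvexCone.positive ℝ ℝ).comap (-ℓ a)) ψ
        (g₀ := g₀ + g₁) ((hle _).2 ⟨hmem, hneg.le⟩)
        (fun i hi => by rw [map_add]; linarith [hfeas.2 i hi, hg₁s i hi])
        (by
          intro g hg
          obtain ⟨hgΓ, -⟩ := (hle g).1 hg
          obtain ⟨N, hN, g', hg', -, hg's⟩ := hri g hgΓ
          obtain ⟨k, hk⟩ := exists_nat_gt (ℓ a (g' + N • g₁) / (-ℓ a (g₀ + g₁)))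
          rw [div_lt_iff₀ (neg_pos.2 hneg)] at hk
          have hk1 : (0 : ℝ) < k + 1 := by positivity
          refine ⟨N + (k + 1), by positivity, g' + N • g₁ + ((k : ℝ) + 1) • (g₀ + g₁),
            (hle _).2 ⟨Γ.add_mem (Γ.add_mem hg' (Γ.smul_mem hN hg₁)) (Γ.smul_mem hk1 hmem), ?_⟩,
            fun i hi => ?_⟩
          · rw [map_add, map_smul, smul_eq_mul]
            linarith
          · simp only [map_add, map_smul, smul_eq_mul, hg's i hi]
            ring)
        (fun g hg h => hψ g ((hle g).1 hg).1 ⟨((hle g).1 hg).2, h⟩)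
      obtain ⟨ν, hν, hνψ⟩ := Γ.exists_nonneg_multiplier_of_neg (ℓ a)
        (ψ - ∑ i ∈ s, c i • ℓ i) hmem hneg
        (fun g hg h => by
          have := hcψ g ((hle g).2 ⟨hg, h⟩)
          simpa using this)
      refine ⟨Function.update c a ν, hupd c ν hc hν, fun g hg => ?_⟩
      have := hνψ g hg
      simp only [LinearMap.sub_apply, LinearMap.sum_apply, LinearMap.smul_apply,
        smul_eq_mul] at this
      rw [hsum]
      linarith
    · push Not at hstrict
      have ha0 : ℓ a g₀ = 0 := le_antisymm hfeas.1 (hstrict g₀ hg₀ hfeas.2)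
      have hri' : ∀ g ∈ Γ, ∃ N : ℝ, 0 < N ∧ ∃ g' ∈ Γ, ∀ i ∈ s, ℓ i g' = N * ℓ i g₀ - ℓ i g := by
        intro g hg
        obtain ⟨N, hN, g', hg', -, h⟩ := hri g hg
        exact ⟨N, hN, g', hg', h⟩
      obtain ⟨d, hd, hdψ⟩ := ih Γ (-ℓ a) hg₀ hfeas.2 hri'
        (fun g hg h => by simpa using hstrict g hg h)
      have heq : ∀ g, g ∈ Γ ⊓ (ConvexCone.positive ℝ ℝ).comap (-ℓ a)
          ⊓ (ConvexCone.positive ℝ ℝ).comap (ℓ a) ↔ g ∈ Γ ∧ ℓ a g = 0 := by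
        intro g
        rw [ConvexCone.mem_inf, hle, ConvexCone.mem_comap, ConvexCone.mem_positive, and_assoc,
          ← le_antisymm_iff]
      obtain ⟨c, hc, hcψ⟩ := ih (Γ ⊓ (ConvexCone.positive ℝ ℝ).comap (-ℓ a)
          ⊓ (ConvexCone.positive ℝ ℝ).comap (ℓ a)) ψ ((heq _).2 ⟨hg₀, ha0⟩) hfeas.2
        (by
          intro g hg
          obtain ⟨hgΓ, hg0⟩ := (heq g).1 hg
          obtain ⟨N, hN, g', hg', hg'a, h⟩ := hri g hgΓ
          exact ⟨N, hN, g', (heq _).2 ⟨hg', by rw [hg'a, ha0, hg0]; ring⟩, h⟩)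
        (fun g hg h => hψ g ((heq g).1 hg).1 ⟨((heq g).1 hg).2.le, h⟩)
      obtain ⟨ν, hν⟩ := Γ.exists_multiplier_of_eq_zero (ℓ a) (ψ - ∑ i ∈ s, c i • ℓ i)
        (by
          constructor <;>
          · rintro ⟨g, hg, h⟩
            obtain ⟨N, -, g', hg', hg'a, -⟩ := hri g hg
            exact ⟨g', hg', by rw [hg'a, ha0]; linarith⟩)
        (fun g hg h => by
          have := hcψ g ((heq g).2 ⟨hg, h⟩)
          simpa using this)
      have hbound : ∀ g ∈ Γ, ψ g ≤ ν * ℓ a g + ∑ i ∈ s, c i * ℓ i g := by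
        intro g hg
        have := hν g hg
        simp only [LinearMap.sub_apply, LinearMap.sum_apply, LinearMap.smul_apply,
          smul_eq_mul] at this
        linarith
      rcases le_total 0 ν with hν0 | hν0
      · exact ⟨Function.update c a ν, hupd c ν hc hν0, fun g hg => by
          rw [hsum]; exact hbound g hg⟩
      · refine ⟨Function.update (fun i => c i + -ν * d i) a 0,
          hupd _ 0 (fun i => add_nonneg (hc i) (mul_nonneg (neg_nonneg.2 hν0) (hd i))) le_rfl,
          fun g hg => ?_⟩
        rw [hsum]
        have h₁ := hbound g hg
        have h₂ := mul_le_mul_of_nonneg_left (hdψ g hg) (neg_nonneg.2 hν0)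
        have h₃ : ∑ i ∈ s, (c i + -ν * d i) * ℓ i g
            = ∑ i ∈ s, c i * ℓ i g + -ν * ∑ i ∈ s, d i * ℓ i g := by
          rw [Finset.mul_sum, ← Finset.sum_add_distrib]
          exact Finset.sum_congr rfl fun i _ => by ring
        rw [LinearMap.neg_apply] at h₂
        linarith

/-- Lagrange multipliers for affine inequality constraints on a convex set, under the refined
Slater condition. -/
theorem Convex.exists_nonneg_multipliers [Fintype ι] {K : Set W} (hK : Convex ℝ K)
    (ℓ : ι → W →ₗ[ℝ] ℝ) (b : ι → ℝ) (ψ : W →ₗ[ℝ] ℝ) (r : ℝ) {x₀ : W} (hx₀ : x₀ ∈ K)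
    (hfeas : ∀ i, ℓ i x₀ ≤ b i)
    (hri : ∀ x ∈ K, ∃ ε : ℝ, 0 < ε ∧ ∃ x' ∈ K, ∀ i, ℓ i x' = ℓ i x₀ - ε * (ℓ i x - ℓ i x₀))
    (hψ : ∀ x ∈ K, (∀ i, ℓ i x ≤ b i) → ψ x ≤ r) :
    ∃ c : ι → ℝ, (∀ i, 0 ≤ c i) ∧ ∀ x ∈ K, ψ x ≤ r + ∑ i, c i * (ℓ i x - b i) := by
  let lift : (W →ₗ[ℝ] ℝ) → ℝ → W × ℝ →ₗ[ℝ] ℝ := fun f t =>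
    f ∘ₗ LinearMap.fst ℝ W ℝ - t • LinearMap.snd ℝ W ℝ
  have hlift : ∀ f t k x, lift f t (k • (x, (1 : ℝ))) = k * (f x - t) := by
    intro f t k x
    simp [lift]
    ring
  have hmem : ∀ g, g ∈ ConvexCone.hull ℝ (K ×ˢ ({1} : Set ℝ)) ↔
      ∃ k : ℝ, 0 < k ∧ ∃ x ∈ K, k • (x, (1 : ℝ)) = g := by
    intro g
    rw [ConvexCone.mem_hull_of_convex (hK.prod (convex_singleton 1))]
    simp [Set.mem_smul_set]
  have hone : ∀ x ∈ K, ((1 : ℝ) • (x, (1 : ℝ))) ∈ ConvexCone.hull ℝ (K ×ˢ ({1} : Set ℝ)) :=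
    fun x hx => (hmem _).2 ⟨1, one_pos, x, hx, rfl⟩
  obtain ⟨c, hc, h⟩ := (ConvexCone.hull ℝ (K ×ˢ ({1} : Set ℝ))).exists_nonneg_multipliers
    Finset.univ (fun i => lift (ℓ i) (b i)) (lift ψ r) (hone x₀ hx₀)
    (fun i _ => by rw [hlift]; linarith [hfeas i])
    (by
      intro g hg
      obtain ⟨k, hk, x, hx, rfl⟩ := (hmem g).1 hg
      obtain ⟨ε, hε, x', hx', hx'ℓ⟩ := hri x hx
      refine ⟨k * (1 + ε) / ε, by positivity, (k / ε) • (x', 1),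
        (hmem _).2 ⟨k / ε, by positivity, x', hx', rfl⟩, fun i _ => ?_⟩
      simp only [hlift, hx'ℓ]
      field_simp
      ring)
    (by
      intro g hg hgs
      obtain ⟨k, hk, x, hx, rfl⟩ := (hmem g).1 hg
      simp only [hlift] at hgs ⊢
      refine mul_nonpos_of_nonneg_of_nonpos hk.le (sub_nonpos.2 (hψ x hx fun i => ?_))
      exact sub_nonpos.1 (nonpos_of_mul_nonpos_right (hgs i (Finset.mem_univ i)) hk))
  refine ⟨c, hc, fun x hx => ?_⟩
  have := h _ (hone x hx)
  simp only [hlift, one_mul] at this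
  linarith

end Multipliers

section Coupling

variable {V₁ V₂ κ : Type*} [AddCommGroup V₁] [Module ℝ V₁] [AddCommGroup V₂] [Module ℝ V₂]

/-- `A` is the part of a convex set cut out by finitely many affine inequalities, such that `a₀`
is a relatively interior point of that convex set as far as the values of `L` and of the
constraints are concerned. -/
def IsRegularAt (A : Set V₁) (L : V₁ →ₗ[ℝ] κ → ℝ) (a₀ : V₁) : Prop :=
  ∃ (A' : Set V₁) (m : ℕ) (ℓ : Fin m → V₁ →ₗ[ℝ] ℝ) (b : Fin m → ℝ), Convex ℝ A' ∧
    A = {a ∈ A' | ∀ i, ℓ i a ≤ b i} ∧ ∀ a ∈ A', ∀ᶠ δ in 𝓝[>] (0 : ℝ), ∃ a' ∈ A',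
      (∀ j, L a' j = L a₀ j - δ * (L a j - L a₀ j)) ∧ ∀ i, ℓ i a' = ℓ i a₀ - δ * (ℓ i a - ℓ i a₀)

theorem isRegularAt_of_polyhedral {m : ℕ} (ℓ : Fin m → V₁ →ₗ[ℝ] ℝ) (b : Fin m → ℝ)
    (L : V₁ →ₗ[ℝ] κ → ℝ) (a₀ : V₁) : IsRegularAt {a | ∀ i, ℓ i a ≤ b i} L a₀ :=
  ⟨Set.univ, m, ℓ, b, convex_univ, by simp, fun a _ => Eventually.of_forall fun δ =>
    ⟨a₀ - δ • (a - a₀), trivial, by simp, by simp⟩⟩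

lemma eventually_mem_of_mem_intrinsicInterior {E : Type*} [NormedAddCommGroup E]
    [NormedSpace ℝ E] {S : Set E} {y₀ y : E} (hy₀ : y₀ ∈ intrinsicInterior ℝ S) (hy : y ∈ S) :
    ∀ᶠ δ in 𝓝 (0 : ℝ), y₀ - δ • (y - y₀) ∈ S := by
  obtain ⟨z, hz, rfl⟩ := mem_intrinsicInterior.1 hy₀
  let γ : ℝ → affineSpan ℝ S := fun δ =>
    ⟨AffineMap.lineMap (z : E) y (-δ),
      AffineMap.lineMap_mem _ z.2 (subset_affineSpan ℝ S hy)⟩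
  have hγ : Continuous γ := by
    refine Continuous.subtype_mk ?_ _
    simp only [AffineMap.lineMap_apply_module']
    fun_prop
  have hγ0 : γ 0 = z := by
    ext
    simp [γ]
  have hev : ∀ᶠ δ in 𝓝 (0 : ℝ), γ δ ∈ interior (Subtype.val ⁻¹' S) :=
    hγ.continuousAt.eventually (by rw [hγ0]; exact isOpen_interior.mem_nhds hz)
  filter_upwards [hev] with δ hδ
  have : γ δ ∈ (Subtype.val ⁻¹' S : Set (affineSpan ℝ S)) := interior_subset hδ
  rw [Set.mem_preimage] at this
  convert this using 1
  simp only [γ, AffineMap.lineMap_apply_module']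
  module

theorem isRegularAt_of_mem_intrinsicInterior [Fintype κ] {A : Set V₁} (hA : Convex ℝ A)
    (L : V₁ →ₗ[ℝ] κ → ℝ) {a₀ : V₁} (ha₀ : L a₀ ∈ intrinsicInterior ℝ (L '' A)) :
    IsRegularAt A L a₀ := by
  refine ⟨A, 0, Fin.elim0, Fin.elim0, hA, by simp, fun a ha => ?_⟩
  filter_upwards [nhdsWithin_le_nhds
    (eventually_mem_of_mem_intrinsicInterior ha₀ ⟨a, ha, rfl⟩)] with δ hδ
  obtain ⟨a', ha', h⟩ := hδ
  exact ⟨a', ha', fun j => by simp [h], fun i => i.elim0⟩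

/-- Dualization of the coupling constraint `L₁ a = L₂ b` under a regularity condition. -/
theorem exists_coupling_multiplier [Fintype κ] {A : Set V₁} {B : Set V₂}
    {L₁ : V₁ →ₗ[ℝ] κ → ℝ} {L₂ : V₂ →ₗ[ℝ] κ → ℝ} {a₀ : V₁} {b₀ : V₂}
    (hA : IsRegularAt A L₁ a₀) (hB : IsRegularAt B L₂ b₀) (ha₀ : a₀ ∈ A) (hb₀ : b₀ ∈ B)
    (h₀ : L₁ a₀ = L₂ b₀) (ψ₁ : V₁ →ₗ[ℝ] ℝ) (ψ₂ : V₂ →ₗ[ℝ] ℝ) (r : ℝ)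
    (hψ : ∀ a ∈ A, ∀ b ∈ B, L₁ a = L₂ b → ψ₁ a + ψ₂ b ≤ r) :
    ∃ v : κ → ℝ, ∀ a ∈ A, ∀ b ∈ B, ψ₁ a + ψ₂ b ≤ r + ∑ j, v j * (L₁ a j - L₂ b j) := by
  obtain ⟨A', m₁, ℓ₁, β₁, hA', rfl, hriA⟩ := hA
  obtain ⟨B', m₂, ℓ₂, β₂, hB', rfl, hriB⟩ := hB
  let π₁ := LinearMap.fst ℝ V₁ V₂
  let π₂ := LinearMap.snd ℝ V₁ V₂
  let D : κ → V₁ × V₂ →ₗ[ℝ] ℝ := fun j =>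
    LinearMap.proj j ∘ₗ (L₁ ∘ₗ π₁ - L₂ ∘ₗ π₂)
  have hD : ∀ j x, D j x = L₁ x.1 j - L₂ x.2 j := fun j x => by simp [D, π₁, π₂]
  obtain ⟨c, hc, h⟩ := (hA'.prod hB').exists_nonneg_multipliers
    (Sum.elim (Sum.elim D fun j => -D j)
      (Sum.elim (fun i => ℓ₁ i ∘ₗ π₁) fun i => ℓ₂ i ∘ₗ π₂))
    (Sum.elim (Sum.elim 0 0) (Sum.elim β₁ β₂)) (ψ₁ ∘ₗ π₁ + ψ₂ ∘ₗ π₂) r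
    (x₀ := (a₀, b₀)) ⟨ha₀.1, hb₀.1⟩
    (by
      rintro ((j | j) | (i | i))
      · simp [hD, h₀]
      · simp [hD, h₀]
      · exact ha₀.2 i
      · exact hb₀.2 i)
    (by
      rintro ⟨a, b⟩ ⟨ha, hb⟩
      obtain ⟨δ, ⟨⟨a', ha', hLa, hℓa⟩, b', hb', hLb, hℓb⟩, hδ⟩ :=
        (((hriA a ha).and (hriB b hb)).and self_mem_nhdsWithin).exists
      refine ⟨δ, hδ, (a', b'), ⟨ha', hb'⟩, ?_⟩
      rintro ((j | j) | (i | i))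
      · simp only [Sum.elim_inl, hD, hLa, hLb]
        ring
      · simp only [Sum.elim_inl, Sum.elim_inr, LinearMap.neg_apply, hD, hLa, hLb]
        ring
      · exact hℓa i
      · exact hℓb i)
    (by
      rintro ⟨a, b⟩ ⟨ha, hb⟩ hx
      refine hψ a ⟨ha, fun i => hx (.inr (.inl i))⟩ b ⟨hb, fun i => hx (.inr (.inr i))⟩ ?_
      funext j
      have h₁ := hx (.inl (.inl j))
      have h₂ := hx (.inl (.inr j))
      simp only [Sum.elim_inl, Sum.elim_inr, LinearMap.neg_apply, hD, Pi.zero_apply] at h₁ h₂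
      linarith)
  refine ⟨fun j => c (.inl (.inl j)) - c (.inl (.inr j)), fun a ha b hb => ?_⟩
  have hab := h (a, b) ⟨ha.1, hb.1⟩
  simp only [Fintype.sum_sum_type, Sum.elim_inl, Sum.elim_inr, LinearMap.neg_apply, hD,
    Pi.zero_apply, LinearMap.add_apply, LinearMap.comp_apply, π₁, π₂, LinearMap.fst_apply,
    LinearMap.snd_apply] at hab
  have hs₁ : ∑ i, c (.inr (.inl i)) * (ℓ₁ i a - β₁ i) ≤ 0 := Finset.sum_nonpos fun i _ =>
    mul_nonpos_of_nonneg_of_nonpos (hc _) (sub_nonpos.2 (ha.2 i))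
  have hs₂ : ∑ i, c (.inr (.inr i)) * (ℓ₂ i b - β₂ i) ≤ 0 := Finset.sum_nonpos fun i _ =>
    mul_nonpos_of_nonneg_of_nonpos (hc _) (sub_nonpos.2 (hb.2 i))
  have hs₃ : ∑ j, (c (.inl (.inl j)) - c (.inl (.inr j))) * (L₁ a j - L₂ b j)
      = ∑ j, c (.inl (.inl j)) * (L₁ a j - L₂ b j - 0)
        + ∑ j, c (.inl (.inr j)) * (-(L₁ a j - L₂ b j) - 0) := by
    rw [← Finset.sum_add_distrib]
    exact Finset.sum_congr rfl fun j _ => by ring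
  rw [hs₃]
  linarith

end Coupling

section SetValued

variable {n p q : ℕ}

lemma sdot_neg_left (u x : Fin n → ℝ) : sdot (-u) x = -sdot u x := by
  simp [sdot]

/-- The linear functional `(x, y) ↦ ⟨u, x⟩ + ⟨v, y⟩`. -/
def pairing (u : Fin n → ℝ) (v : Fin p → ℝ) : (Fin n → ℝ) × (Fin p → ℝ) →ₗ[ℝ] ℝ where
  toFun t := sdot u t.1 + sdot v t.2
  map_add' s t := by simp [sdot, mul_add, Finset.sum_add_distrib]; ring
  map_smul' k t := by simp [sdot, Finset.mul_sum, mul_add, mul_left_comm]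

lemma pairing_apply (u : Fin n → ℝ) (v : Fin p → ℝ) (t) :
    pairing u v t = sdot u t.1 + sdot v t.2 := rfl

lemma coe_le_svConj {F : (Fin n → ℝ) → Set (Fin p → ℝ)} {x y} (h : y ∈ F x) (u v) :
    ((sdot u x + sdot v y : ℝ) : EReal) ≤ svConj F u v :=
  le_sSup ⟨(x, y), h, rfl⟩

lemma svConj_add_le {F : (Fin n → ℝ) → Set (Fin p → ℝ)} {G : (Fin p → ℝ) → Set (Fin q → ℝ)}
    {u v v' w} {r : ℝ}
    (h : ∀ x, ∀ y ∈ F x, ∀ y', ∀ z ∈ G y',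
      sdot u x + sdot v y + (sdot v' y' + sdot w z) ≤ r) :
    svConj F u v + svConj G v' w ≤ r := by
  refine EReal.add_le_of_forall_lt fun a ha b hb => ?_
  obtain ⟨_, ⟨⟨x, y⟩, hxy, rfl⟩, ha⟩ := lt_sSup_iff.1 ha
  obtain ⟨_, ⟨⟨y', z⟩, hyz, rfl⟩, hb⟩ := lt_sSup_iff.1 hb
  refine (add_le_add ha.le hb.le).trans ?_
  rw [← EReal.coe_add, EReal.coe_le_coe_iff]
  exact h x y hxy y' z hyz

/-- The part of the chain rule that needs no convexity. -/
lemma svConj_comp_le (F : (Fin n → ℝ) → Set (Fin p → ℝ)) (G : (Fin p → ℝ) → Set (Fin q → ℝ))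
    (u v w) :
    svConj (fun x => {z | ∃ y ∈ F x, z ∈ G y}) u w ≤ svConj F u v + svConj G (-v) w := by
  refine sSup_le ?_
  rintro _ ⟨⟨x, z⟩, ⟨y, hy, hz⟩, rfl⟩
  refine le_trans ?_ (add_le_add (coe_le_svConj hy u v) (coe_le_svConj hz (-v) w))
  rw [← EReal.coe_add, EReal.coe_le_coe_iff, sdot_neg_left]
  linarith

lemma IsPolyMap.isRegularAt {κ : Type*} {F : (Fin n → ℝ) → Set (Fin p → ℝ)} (hF : IsPolyMap F)
    (L : (Fin n → ℝ) × (Fin p → ℝ) →ₗ[ℝ] κ → ℝ) (t₀) : IsRegularAt {t | t.2 ∈ F t.1} L t₀ := by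
  obtain ⟨m, a, c, b, h⟩ := hF
  rw [h]
  exact isRegularAt_of_polyhedral (fun i => pairing (a i) (c i)) b L t₀

lemma srge_eq_image (F : (Fin n → ℝ) → Set (Fin p → ℝ)) :
    srge F = LinearMap.snd ℝ (Fin n → ℝ) (Fin p → ℝ) '' {t | t.2 ∈ F t.1} := by
  ext y
  simp [srge]

lemma sdom_eq_image (F : (Fin n → ℝ) → Set (Fin p → ℝ)) :
    sdom F = LinearMap.fst ℝ (Fin n → ℝ) (Fin p → ℝ) '' {t | t.2 ∈ F t.1} := by
  ext x
  simp [sdom, Set.Nonempty]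

/-- Attainment in the chain rule when both graphs are regular at a common intermediate point. -/
theorem exists_svConj_add_le {F : (Fin n → ℝ) → Set (Fin p → ℝ)}
    {G : (Fin p → ℝ) → Set (Fin q → ℝ)} {x₀ y₀ z₀} (hxy : y₀ ∈ F x₀) (hyz : z₀ ∈ G y₀)
    (hF : IsRegularAt {t | t.2 ∈ F t.1} (LinearMap.snd ℝ (Fin n → ℝ) (Fin p → ℝ)) (x₀, y₀))
    (hG : IsRegularAt {t | t.2 ∈ G t.1} (LinearMap.fst ℝ (Fin p → ℝ) (Fin q → ℝ)) (y₀, z₀))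
    {u w} {r : ℝ} (h : svConj (fun x => {z | ∃ y ∈ F x, z ∈ G y}) u w ≤ r) :
    ∃ v, svConj F u v + svConj G (-v) w ≤ r := by
  obtain ⟨v, hv⟩ := exists_coupling_multiplier hF hG hxy hyz rfl (pairing u 0) (pairing 0 w) r
    (by
      rintro ⟨x, y⟩ hx ⟨y', z⟩ hz hyy
      obtain rfl : y = y' := hyy
      have := (coe_le_svConj (F := fun x => {z | ∃ y ∈ F x, z ∈ G y}) ⟨y, hx, hz⟩ u w).trans h
      rw [EReal.coe_le_coe_iff] at this
      simpa [pairing_apply, sdot] using this)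
  refine ⟨-v, svConj_add_le fun x y hx y' z hz => ?_⟩
  have := hv (x, y) hx (y', z) hz
  simp only [pairing_apply, LinearMap.snd_apply, LinearMap.fst_apply, mul_sub,
    Finset.sum_sub_distrib] at this
  have h0 : sdot (0 : Fin p → ℝ) y = 0 ∧ sdot (0 : Fin p → ℝ) y' = 0 := by simp [sdot]
  rw [h0.1, h0.2] at this
  rw [neg_neg, sdot_neg_left]
  simp only [sdot] at this ⊢
  linarith

end SetValued

/-- Fenchel conjugate chain rule for set-valued mappings in finite dimensions. -/
theorem svConj_chain_rule {n p q : ℕ}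
    (F : (Fin n → ℝ) → Set (Fin p → ℝ)) (G : (Fin p → ℝ) → Set (Fin q → ℝ))
    (u : Fin n → ℝ) (w : Fin q → ℝ) :
    svConj (fun x => {z | ∃ y ∈ F x, z ∈ G y}) u w ≤
      sInf {z : EReal | ∃ v : Fin p → ℝ, z = svConj F u v + svConj G (-v) w} ∧
    ((Convex ℝ {t : (Fin n → ℝ) × (Fin p → ℝ) | t.2 ∈ F t.1} ∧
        Convex ℝ {t : (Fin p → ℝ) × (Fin q → ℝ) | t.2 ∈ G t.1} ∧
        (intrinsicInterior ℝ (srge F) ∩ intrinsicInterior ℝ (sdom G)).Nonempty) ∨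
      (IsPolyMap F ∧ Convex ℝ {t : (Fin p → ℝ) × (Fin q → ℝ) | t.2 ∈ G t.1} ∧
        (srge F ∩ intrinsicInterior ℝ (sdom G)).Nonempty) ∨
      (Convex ℝ {t : (Fin n → ℝ) × (Fin p → ℝ) | t.2 ∈ F t.1} ∧ IsPolyMap G ∧
        (intrinsicInterior ℝ (srge F) ∩ sdom G).Nonempty) ∨
      (IsPolyMap F ∧ IsPolyMap G ∧ (srge F ∩ sdom G).Nonempty) →
      svConj (fun x => {z | ∃ y ∈ F x, z ∈ G y}) u w =
        sInf {z : EReal | ∃ v : Fin p → ℝ, z = svConj F u v + svConj G (-v) w} ∧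
      (∀ r : ℝ, svConj (fun x => {z | ∃ y ∈ F x, z ∈ G y}) u w = (r : EReal) →
        ∃ v : Fin p → ℝ,
          svConj (fun x => {z | ∃ y ∈ F x, z ∈ G y}) u w =
            svConj F u v + svConj G (-v) w)) := by
  have hle : svConj (fun x => {z | ∃ y ∈ F x, z ∈ G y}) u w ≤
      sInf {z : EReal | ∃ v : Fin p → ℝ, z = svConj F u v + svConj G (-v) w} := by
    refine le_sInf ?_
    rintro _ ⟨v, rfl⟩
    exact svConj_comp_le F G u v w
  refine ⟨hle, fun hcases => ?_⟩
  obtain ⟨x₀, y₀, z₀, hxy, hyz, hF, hG⟩ : ∃ x₀ y₀ z₀, y₀ ∈ F x₀ ∧ z₀ ∈ G y₀ ∧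
      IsRegularAt {t | t.2 ∈ F t.1} (LinearMap.snd ℝ (Fin n → ℝ) (Fin p → ℝ)) (x₀, y₀) ∧
      IsRegularAt {t | t.2 ∈ G t.1} (LinearMap.fst ℝ (Fin p → ℝ) (Fin q → ℝ)) (y₀, z₀) := by
    rcases hcases with ⟨hF, hG, y, hyF, hyG⟩ | ⟨hF, hG, y, hyF, hyG⟩ | ⟨hF, hG, y, hyF, hyG⟩ |
      ⟨hF, hG, y, ⟨x, hx⟩, z, hz⟩
    · obtain ⟨x, hx⟩ := intrinsicInterior_subset hyF
      obtain ⟨z, hz⟩ := intrinsicInterior_subset hyG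
      rw [srge_eq_image] at hyF
      rw [sdom_eq_image] at hyG
      exact ⟨x, y, z, hx, hz, isRegularAt_of_mem_intrinsicInterior hF _ hyF,
        isRegularAt_of_mem_intrinsicInterior hG _ hyG⟩
    · obtain ⟨x, hx⟩ := hyF
      obtain ⟨z, hz⟩ := intrinsicInterior_subset hyG
      rw [sdom_eq_image] at hyG
      exact ⟨x, y, z, hx, hz, hF.isRegularAt _ _, isRegularAt_of_mem_intrinsicInterior hG _ hyG⟩
    · obtain ⟨x, hx⟩ := intrinsicInterior_subset hyF
      obtain ⟨z, hz⟩ := hyG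
      rw [srge_eq_image] at hyF
      exact ⟨x, y, z, hx, hz, isRegularAt_of_mem_intrinsicInterior hF _ hyF, hG.isRegularAt _ _⟩
    · exact ⟨x, y, z, hx, hz, hF.isRegularAt _ _, hG.isRegularAt _ _⟩
  have hattain : ∀ r : ℝ, svConj (fun x => {z | ∃ y ∈ F x, z ∈ G y}) u w = r → ∃ v : Fin p → ℝ,
      svConj (fun x => {z | ∃ y ∈ F x, z ∈ G y}) u w = svConj F u v + svConj G (-v) w := by
    intro r hr
    obtain ⟨v, hv⟩ := exists_svConj_add_le hxy hyz hF hG hr.le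
    exact ⟨v, le_antisymm (svConj_comp_le F G u v w) (hr ▸ hv)⟩
  refine ⟨le_antisymm hle ?_, hattain⟩
  rcases eq_or_ne (svConj (fun x => {z | ∃ y ∈ F x, z ∈ G y}) u w) ⊤ with htop | htop
  · rw [htop]
    exact le_top
  · have hbot : svConj (fun x => {z | ∃ y ∈ F x, z ∈ G y}) u w ≠ ⊥ := ne_bot_of_le_ne_bot
      (EReal.coe_ne_bot _)
      (coe_le_svConj (F := fun x => {z | ∃ y ∈ F x, z ∈ G y}) ⟨y₀, hxy, hyz⟩ u w)
    obtain ⟨v, hv⟩ := hattain _ (EReal.coe_toReal htop hbot).symm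
    exact sInf_le ⟨v, hv⟩

end
end
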